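/- For every m ≥ 0 and every 0 ≤ i ≤ m, the order-preserving maps [1]^{m+1} → [m] given by α_m ∘ ε_i and by υ_i ∘ α_{m+1} coincide, where ε_i: [1]^{m+1} → [1]^m is the i-th cubical degeneracy: ε_0(r_1,…,r_{m+1}) = (r_2,…,r_{m+1}) and, for i ≥ 1, ε_i(r_1,…,r_{m+1}) = (r_1,…,r_{i−1}, max{r_i, r_{i+1}}, r_{i+2},…,r_{m+1}). -/

import Mathlib

namespace CubeBlowup

/-- The poset `[1]^m = {0,1}^m`; the coordinate `r_{i+1}` of the paper is `r i`. -/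
abbrev Cube (m : ℕ) := Fin m → Fin 2

/-- The cubical blow-up map `α_m : [1]^m → [m]`, `α(r) = max { i : r_i = 1 }`
(with value `0` if all coordinates vanish). -/
def alpha (m : ℕ) (r : Cube m) : Fin (m + 1) :=
  ⟨Finset.univ.sup (fun i : Fin m => if r i = 1 then i.1 + 1 else 0), by
    apply Nat.lt_succ_of_le
    apply Finset.sup_le
    intro i _
    have := i.2
    split <;> omega⟩

/-- The map `δ_{i|v} : [1]^{m} → [1]^{m+1}` inserting the constant `v` as the `i`-th
coordinate (`1 ≤ i ≤ m+1`). -/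
def insertCoord (m i : ℕ) (h1 : 1 ≤ i) (h2 : i ≤ m + 1) (v : Fin 2) (r : Cube m) :
    Cube (m + 1) := fun j =>
  if hj : j.1 + 1 < i then r ⟨j.1, by have := j.2; omega⟩
  else if hj' : j.1 + 1 = i then v
  else r ⟨j.1 - 1, by have := j.2; omega⟩

/-- The coface `δ_i : [m] → [m+1]`, the order-preserving injection omitting `i`. -/
def coface (m i : ℕ) (j : Fin (m + 1)) : Fin (m + 2) :=
  if j.1 < i then ⟨j.1, by have := j.2; omega⟩ else ⟨j.1 + 1, by have := j.2; omega⟩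

/-- The codegeneracy `υ_i : [m+1] → [m]`, the order-preserving surjection with
`υ_i(i) = υ_i(i+1) = i`. -/
def codegen (m i : ℕ) (h : i ≤ m) (j : Fin (m + 2)) : Fin (m + 1) :=
  if hj : j.1 ≤ i then ⟨j.1, by omega⟩ else ⟨j.1 - 1, by have := j.2; omega⟩

/-- The cubical degeneracy `ε_i : [1]^{m+1} → [1]^m` (`0 ≤ i ≤ m`): `ε_0` drops the
first coordinate, and for `i ≥ 1`, `ε_i` replaces the coordinates `r_i, r_{i+1}` by
`max {r_i, r_{i+1}}`. -/
def cubeDegen (m i : ℕ) (h : i ≤ m) (r : Cube (m + 1)) : Cube m := fun j =>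
  if i = 0 then r ⟨j.1 + 1, by have := j.2; omega⟩
  else if j.1 + 1 < i then r ⟨j.1, by have := j.2; omega⟩
  else if j.1 + 1 = i then max (r ⟨i - 1, by omega⟩) (r ⟨i, by omega⟩)
  else r ⟨j.1 + 1, by have := j.2; omega⟩

end CubeBlowup

namespace CubeBlowup

theorem alpha_le_iff (m : ℕ) (r : Cube m) (k : ℕ) :
    (alpha m r).1 ≤ k ↔ ∀ j : Fin m, r j = 1 → j.1 + 1 ≤ k := by
  simp only [alpha, Finset.sup_le_iff, Finset.mem_univ, true_implies]
  refine forall_congr' fun j => ?_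
  split_ifs with hj <;> simp [hj]

/-- The left adjoint property of the codegeneracy. -/
theorem codegen_le_iff (m i : ℕ) (h : i ≤ m) (a : Fin (m + 2)) (k : ℕ) :
    (codegen m i h a).1 ≤ k ↔ a.1 ≤ if k < i then k else k + 1 := by
  unfold codegen
  split_ifs <;> simp only <;> omega

theorem max_eq_one_iff (a b : Fin 2) : max a b = 1 ↔ a = 1 ∨ b = 1 := by
  revert a b
  decide

theorem cubeDegen_eq_one_iff (m i : ℕ) (h : i ≤ m) (r : Cube (m + 1)) (j : Fin m) :
    cubeDegen m i h r j = 1 ↔ ∃ l : Fin (m + 1), r l = 1 ∧ codegen m i h l.succ = j.succ := by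
  have hc (l : Fin (m + 1)) : codegen m i h l.succ = j.succ ↔
      (l.1 + 1 ≤ i ∧ l.1 = j.1) ∨ (i < l.1 + 1 ∧ l.1 = j.1 + 1) := by
    have hl : l.succ.1 = l.1 + 1 := rfl
    have hj : j.succ.1 = j.1 + 1 := rfl
    rw [Fin.ext_iff, hj]
    unfold codegen
    split_ifs <;> simp only <;> omega
  have hj := j.2
  simp only [hc]
  unfold cubeDegen
  split_ifs with h0 h1 h2
  · refine ⟨fun hr => ⟨_, hr, by grind⟩, ?_⟩
    rintro ⟨l, hl, hlj⟩
    rwa [show l = ⟨j.1 + 1, by omega⟩ from Fin.ext (by simp only; omega)] at hl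
  · refine ⟨fun hr => ⟨_, hr, by grind⟩, ?_⟩
    rintro ⟨l, hl, hlj⟩
    rwa [show l = ⟨j.1, by omega⟩ from Fin.ext (by simp only; omega)] at hl
  · rw [max_eq_one_iff]
    constructor
    · rintro (hr | hr)
      · exact ⟨_, hr, by grind⟩
      · exact ⟨_, hr, by grind⟩
    · rintro ⟨l, hl, hlj | hlj⟩
      · left
        rwa [show l = ⟨i - 1, by omega⟩ from Fin.ext (by simp only; omega)] at hl
      · right
        rwa [show l = ⟨i, by omega⟩ from Fin.ext (by simp only; omega)] at hl
  · refine ⟨fun hr => ⟨_, hr, by grind⟩, ?_⟩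
    rintro ⟨l, hl, hlj⟩
    rwa [show l = ⟨j.1 + 1, by omega⟩ from Fin.ext (by simp only; omega)] at hl

/-- For `m ≥ 0` and `0 ≤ i ≤ m`, the order-preserving maps
`[1]^{m+1} → [m]` given by `α_m ∘ ε_i` and by `υ_i ∘ α_{m+1}` coincide. -/
theorem statement_17 (m i : ℕ) (h : i ≤ m) (r : Cube (m + 1)) :
    alpha m (cubeDegen m i h r) = codegen m i h (alpha (m + 1) r) := by
  refine Fin.ext (eq_of_forall_ge_iff fun k => ?_)
  rw [codegen_le_iff, alpha_le_iff, alpha_le_iff]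
  simp only [cubeDegen_eq_one_iff]
  have hc (l : Fin (m + 1)) := codegen_le_iff m i h l.succ k
  simp only [Fin.val_succ] at hc
  simp only [← hc]
  constructor
  · intro H l hl
    rcases Fin.eq_zero_or_eq_succ (codegen m i h l.succ) with h0 | ⟨j, hj⟩
    · simp [h0]
    · simpa [hj] using H j ⟨l, hl, hj⟩
  · rintro H j ⟨l, hl, hj⟩
    simpa [hj] using H l hl

end CubeBlowup
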